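/- Let k be a field of characteristic zero, n ≥ 3, R = k[x_1,…,x_n] standard graded, and let f ∈ R be a nonzero reduced homogeneous polynomial of degree d ≥ 3 whose partial derivatives f_{x_1},…,f_{x_n} are k-linearly independent. Let C_f = R^n / Σ_{i=1}^n R·∇f_{x_i} be the cokernel of the Hessian matrix of f. Then the following are equivalent: (i) the analytic spread of the Jacobian ideal is maximal, ℓ(J_f) = n, i.e., the Krull dimension of the k-subalgebra k[f_{x_1},…,f_{x_n}] of R equals n; (ii) the R-module C_f has Krull dimension n − 1; (iii) the gradient vectors ∇f_{x_1},…,∇f_{x_n} ∈ R^n are linearly independent over R (equivalently, the Hessian determinant of f is nonzero). -/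

import Mathlib

open MvPolynomial

namespace S18
variable {k : Type*} [Field k] {n : ℕ}

noncomputable def phi (k : Type*) [Field k] (n i : ℕ) :
    MvPolynomial (Fin n) k →ₐ[k] MvPolynomial (Fin n) k :=
  aeval (fun j => if (j : ℕ) < i then 0 else X j)

lemma phi_comp (i : ℕ) (p : MvPolynomial (Fin n) k) :
    phi k n (i+1) (phi k n i p) = phi k n (i+1) p := by
  have : (phi k n (i+1)).comp (phi k n i) = phi k n (i+1) := by
    apply MvPolynomial.algHom_ext
    intro j
    simp only [phi, AlgHom.comp_apply, aeval_X]
    by_cases h : (j : ℕ) < i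
    · simp [h, Nat.lt_succ_of_lt h]
    · simp [h]
  exact DFunLike.congr_fun this p

lemma height_ker (i : ℕ) (hi : i ≤ n) :
    (i : ℕ∞) ≤ (RingHom.ker (phi k n i)).height := by
  induction i with
  | zero => simp
  | succ i ih =>
    have h1 := ih (by omega)
    have hlt : RingHom.ker (phi k n i) < RingHom.ker (phi k n (i+1)) := by
      refine lt_of_le_of_ne ?_ ?_
      · intro p hp
        rw [RingHom.mem_ker] at hp ⊢
        rw [← phi_comp, hp, map_zero]
      · intro h
        have : (X ⟨i, hi⟩ : MvPolynomial (Fin n) k) ∈ RingHom.ker (phi k n i) := by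
          rw [h, RingHom.mem_ker]; simp [phi]
        rw [RingHom.mem_ker] at this
        simp [phi] at this
    have := RingHom.ker_isPrime (phi k n i)
    have := RingHom.ker_isPrime (phi k n (i+1))
    have h2 := Ideal.height_add_one_le_of_lt_of_isPrime hlt
    push_cast
    exact le_trans (by gcongr) h2

lemma chain {m : ℕ} (D : Derivation k (MvPolynomial (Fin n) k) (MvPolynomial (Fin n) k))
    (g : Fin m → MvPolynomial (Fin n) k) (P : MvPolynomial (Fin m) k) :
    D (aeval g P) = ∑ i, aeval g (pderiv i P) * D (g i) := by
  classical
  induction P using MvPolynomial.induction_on with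
  | C a => simp [← algebraMap_eq]
  | add p q hp hq => simp only [map_add, hp, hq, add_mul, Finset.sum_add_distrib]
  | mul_X p i hp =>
    simp only [map_mul, aeval_X, Derivation.leibniz, hp, smul_eq_mul, map_add, add_mul,
      Finset.sum_add_distrib, pderiv_X, Pi.single_apply]
    congr 1
    · simp [apply_ite, Finset.sum_ite_eq]
    · rw [Finset.mul_sum]
      simp [mul_assoc]

lemma exists_rel [CharZero k] {m : ℕ} (g : Fin m → MvPolynomial (Fin n) k)
    (h : ¬ AlgebraicIndependent k g) :
    ∃ v : Fin m → MvPolynomial (Fin n) k, v ≠ 0 ∧ ∀ j, ∑ i, v i * pderiv j (g i) = 0 := by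
  classical
  rw [algebraicIndependent_iff] at h
  push Not at h
  have hex : ∃ N, ∃ P : MvPolynomial (Fin m) k, aeval g P = 0 ∧ P ≠ 0 ∧ P.totalDegree = N := by
    obtain ⟨P, h1, h2⟩ := h
    exact ⟨_, P, h1, h2, rfl⟩
  obtain ⟨P, h1, h2, h3⟩ := Nat.find_spec hex
  have hmin := fun N hN => Nat.find_min hex (m := N) hN
  refine ⟨fun i => aeval g (pderiv i P), ?_, fun j => ?_⟩
  · intro h0
    have hz : ∀ i, pderiv i P = 0 := by
      intro i
      by_contra hne
      have hlt : (pderiv i P).totalDegree < Nat.find hex := by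
        rw [← h3]
        have hpos : ∃ s ∈ (pderiv i P).support,
            (pderiv i P).totalDegree = s.sum fun _ e => e := by
          have hs : (pderiv i P).support.Nonempty := by simpa using hne
          obtain ⟨s, hs, he⟩ := Finset.exists_mem_eq_sup _ hs (fun s => s.sum fun _ e => e)
          exact ⟨s, hs, he⟩
        obtain ⟨s, hs, he⟩ := hpos
        rw [he]
        rw [mem_support_iff, coeff_pderiv] at hs
        have hs' : s + Finsupp.single i 1 ∈ P.support := by
          rw [mem_support_iff]; exact left_ne_zero_of_mul hs
        have := le_totalDegree hs'
        rw [Finsupp.sum_add_index' (by simp) (by simp)] at this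
        simp at this
        omega
      exact hmin _ hlt ⟨_, congrFun h0 i, hne, rfl⟩
    obtain ⟨s, hs⟩ := MvPolynomial.ne_zero_iff.1 h2
    have hs0 : s = 0 := by
      ext i
      by_contra hi
      have hi : 1 ≤ s i := Nat.one_le_iff_ne_zero.2 hi
      have hc := coeff_pderiv (i := i) P (s - Finsupp.single i 1)
      rw [hz i, tsub_add_cancel_of_le (by simpa using hi)] at hc
      rw [coeff_zero, eq_comm, mul_eq_zero] at hc
      rcases hc with hc | hc
      · exact hs hc
      · exact absurd hc (Nat.cast_add_one_ne_zero _)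
    have hPC : P = C (coeff 0 P) := by
      ext t
      rw [coeff_C]
      split_ifs with ht
      · rw [ht]
      · obtain ⟨i, hi⟩ : ∃ i, t i ≠ 0 := by
          by_contra hcon
          push Not at hcon
          exact ht (by ext i; simp [hcon i])
        have hi : 1 ≤ t i := Nat.one_le_iff_ne_zero.2 hi
        have hc := coeff_pderiv (i := i) P (t - Finsupp.single i 1)
        rw [hz i, tsub_add_cancel_of_le (by simpa using hi)] at hc
        rw [coeff_zero, eq_comm, mul_eq_zero] at hc
        rcases hc with hc | hc
        · exact hc
        · exact absurd hc (Nat.cast_add_one_ne_zero _)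
    rw [hPC, ← algebraMap_eq, AlgHom.commutes] at h1
    rw [algebraMap_eq, C_eq_zero] at h1
    rw [hs0] at hs
    exact hs h1
  · have := chain (pderiv j) g P
    rw [h1, map_zero] at this
    exact this.symm

lemma der_zero [CharZero k] (A : Subalgebra k (MvPolynomial (Fin n) k))
    (D : Derivation k (MvPolynomial (Fin n) k) (MvPolynomial (Fin n) k))
    (hD : ∀ a ∈ A, D a = 0) (x : MvPolynomial (Fin n) k) (hx : IsAlgebraic A x) : D x = 0 := by
  classical
  have hex : ∃ N, ∃ p : Polynomial A, p ≠ 0 ∧ Polynomial.aeval x p = 0 ∧ p.natDegree = N := by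
    obtain ⟨p, h1, h2⟩ := hx
    exact ⟨_, p, h1, h2, rfl⟩
  obtain ⟨p, h1, h2, h3⟩ := Nat.find_spec hex
  have hmin := fun N hN => Nat.find_min hex (m := N) hN
  have hder : ∀ q : Polynomial A, D (Polynomial.aeval x q)
      = Polynomial.aeval x (Polynomial.derivative q) * D x := by
    intro q
    induction q using Polynomial.induction_on' with
    | add p q hp hq => simp [hp, hq, add_mul]
    | monomial m a =>
      rw [Polynomial.aeval_monomial, Polynomial.derivative_monomial, Polynomial.aeval_monomial,
        Derivation.leibniz, Derivation.leibniz_pow]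
      rw [show algebraMap A (MvPolynomial (Fin n) k) a = (a : MvPolynomial (Fin n) k) from rfl,
        hD a a.2]
      simp
      ring
  have hd0 : p.natDegree ≠ 0 := by
    intro h0
    rw [Polynomial.eq_C_of_natDegree_eq_zero h0] at h2 h1
    rw [Polynomial.aeval_C] at h2
    apply h1
    have : p.coeff 0 = 0 := Subtype.ext h2
    simp [this]
  have h4 := hder p
  rw [h2, map_zero, eq_comm, mul_eq_zero] at h4
  refine h4.resolve_left fun h5 => ?_
  have hlt := Polynomial.natDegree_derivative_lt hd0
  refine hmin _ (h3 ▸ hlt) ⟨_, ?_, h5, rfl⟩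
  intro h6
  exact hd0 (Polynomial.derivative_eq_zero.1 h6)

lemma ker_zero [CharZero k] (g : Fin n → MvPolynomial (Fin n) k)
    (h : AlgebraicIndependent k g) (v : Fin n → MvPolynomial (Fin n) k)
    (hv : ∀ i, ∑ j, pderiv j (g i) * v j = 0) : v = 0 := by
  have hb : IsTranscendenceBasis k g := by
    apply AlgebraicIndependent.isTranscendenceBasis_of_lift_trdeg_le_of_finite h
    simp
  have halg := hb.isAlgebraic
  have hD : ∀ p : MvPolynomial (Fin n) k, mkDerivation k v p = ∑ j, pderiv j p * v j := by
    intro p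
    have := chain (mkDerivation k v) X p
    simpa using this
  funext j
  have : mkDerivation k v (X j) = 0 := by
    refine der_zero (Algebra.adjoin k (Set.range g)) _ ?_ (X j) (halg.isAlgebraic _)
    intro a ha
    have := Derivation.eqOn_adjoin (D1 := mkDerivation k v) (D2 := 0) (s := Set.range g) ?_ ha
    · simpa using this
    · rintro _ ⟨i, rfl⟩
      simp [hD, hv]
  simpa using this

lemma dim_adjoin {m : ℕ} (g : Fin n → MvPolynomial (Fin m) k) :
    ringKrullDim (Algebra.adjoin k (Set.range g)) = (n : WithBot ℕ∞) ↔
      AlgebraicIndependent k g := by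
  have hR : ringKrullDim (MvPolynomial (Fin n) k) = n := by
    rw [MvPolynomial.ringKrullDim_of_isNoetherianRing]; simp
  constructor
  · intro h
    by_contra hna
    rw [algebraicIndependent_iff] at hna
    push Not at hna
    obtain ⟨P, h1, h2⟩ := hna
    rw [Algebra.adjoin_range_eq_range_aeval] at h
    have := ringKrullDim_succ_le_of_surjective (aeval (R := k) g).rangeRestrict.toRingHom
      (AlgHom.rangeRestrict_surjective _) (r := P) (mem_nonZeroDivisors_of_ne_zero h2)
      (Subtype.ext h1)
    rw [hR, h] at this
    have h' : n + 1 ≤ n := by exact_mod_cast this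
    omega
  · intro h
    rw [← ringKrullDim_eq_of_ringEquiv h.aevalEquiv.toRingEquiv, hR]

lemma phi_homog {e : ℕ} (he : e ≠ 0) (p : MvPolynomial (Fin n) k) (hp : p.IsHomogeneous e) :
    phi k n n p = 0 := by
  have h : phi k n n = aeval (fun _ => 0) := by
    apply MvPolynomial.algHom_ext
    intro j
    simp [phi]
  rw [h, aeval_zero', constantCoeff_eq, hp.coeff_eq_zero (by simpa using he.symm), map_zero]

lemma ann_bot (M : Matrix (Fin n) (Fin n) (MvPolynomial (Fin n) k)) (h : M.det = 0) :
    Module.annihilator (MvPolynomial (Fin n) k)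
      ((Fin n → MvPolynomial (Fin n) k) ⧸
        Submodule.span (MvPolynomial (Fin n) k) (Set.range M)) = ⊥ := by
  obtain ⟨v, hv, h0⟩ := Matrix.exists_mulVec_eq_zero_iff.2 h
  rw [eq_bot_iff]
  intro r hr
  rw [Submodule.annihilator_quotient, Submodule.mem_colon] at hr
  obtain ⟨j, hj⟩ := Function.ne_iff.1 hv
  have h1 := hr (Pi.single j 1) trivial
  have h2 : ∀ w ∈ Submodule.span (MvPolynomial (Fin n) k) (Set.range M), w ⬝ᵥ v = 0 := by
    intro w hw
    induction hw using Submodule.span_induction with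
    | mem x hx =>
      obtain ⟨i, rfl⟩ := hx
      exact congrFun h0 i
    | zero => simp
    | add x y _ _ hx hy => rw [add_dotProduct, hx, hy, add_zero]
    | smul a x _ hx => rw [smul_dotProduct, hx, smul_zero]
  have h3 := h2 _ h1
  rw [smul_dotProduct, single_dotProduct, one_mul, smul_eq_mul, mul_eq_zero] at h3
  exact h3.resolve_right hj

lemma det_mem_ann (M : Matrix (Fin n) (Fin n) (MvPolynomial (Fin n) k)) :
    M.det ∈ Module.annihilator (MvPolynomial (Fin n) k)
      ((Fin n → MvPolynomial (Fin n) k) ⧸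
        Submodule.span (MvPolynomial (Fin n) k) (Set.range M)) := by
  rw [Submodule.annihilator_quotient, Submodule.mem_colon]
  intro w _
  have : M.det • w = Matrix.vecMul (Matrix.vecMul w M.adjugate) M := by
    rw [Matrix.vecMul_vecMul, Matrix.adjugate_mul, Matrix.vecMul_smul, Matrix.vecMul_one]
  rw [this, Matrix.vecMul_eq_sum]
  exact Submodule.sum_mem _ fun i _ => Submodule.smul_mem _ _ (Submodule.subset_span ⟨i, rfl⟩)

lemma ann_le (M : Matrix (Fin n) (Fin n) (MvPolynomial (Fin n) k)) :
    Module.annihilator (MvPolynomial (Fin n) k)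
      ((Fin n → MvPolynomial (Fin n) k) ⧸
        Submodule.span (MvPolynomial (Fin n) k) (Set.range M)) ≤
      (Ideal.span {M.det}).radical := by
  intro r hr
  rw [Submodule.annihilator_quotient, Submodule.mem_colon] at hr
  have h1 : ∀ j, ∃ b : Fin n → MvPolynomial (Fin n) k,
      Matrix.vecMul b M = r • Pi.single j 1 := by
    intro j
    obtain ⟨c, hc⟩ := (Submodule.mem_span_range_iff_exists_fun _).1 (hr (Pi.single j 1) trivial)
    exact ⟨c, by rw [Matrix.vecMul_eq_sum, hc]⟩
  choose B hB using h1
  have h2 : Matrix.of B * M = r • (1 : Matrix (Fin n) (Fin n) (MvPolynomial (Fin n) k)) := by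
    ext1 i j
    have := congrFun (hB i) j
    rw [Matrix.mul_apply]
    simp only [Matrix.vecMul, dotProduct] at this
    simp only [Matrix.of_apply, this, Matrix.smul_apply, Pi.smul_apply, Matrix.one_apply,
      Pi.single_apply, eq_comm]
  have h3 := congrArg Matrix.det h2
  rw [Matrix.det_mul, Matrix.det_smul, Matrix.det_one, mul_one, Fintype.card_fin] at h3
  exact ⟨n, h3 ▸ Ideal.mul_mem_left _ _ (Ideal.mem_span_singleton_self _)⟩

lemma arith {n : ℕ} (hn : 0 < n) (x : WithBot ℕ∞) (heq : x + 1 = ((n : ℕ∞) : WithBot ℕ∞)) :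
    x = ((n - 1 : ℕ) : WithBot ℕ∞) := by
  obtain ⟨m, rfl⟩ : ∃ m, n = m + 1 := ⟨n - 1, by omega⟩
  induction x with
  | bot => exact absurd heq (WithBot.bot_ne_coe (a := ((m + 1 : ℕ) : ℕ∞)))
  | coe x =>
    induction x with
    | top => exact absurd heq (by exact_mod_cast ENat.top_ne_natCast _)
    | coe x =>
      have : x + 1 = m + 1 := by exact_mod_cast heq
      have : x = m := by omega
      simp [this]

lemma dim_ann (M : Matrix (Fin n) (Fin n) (MvPolynomial (Fin n) k)) (hn : 0 < n)
    (hM : ∀ i j, phi k n n (M i j) = 0) :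
    ringKrullDim (MvPolynomial (Fin n) k ⧸ Module.annihilator (MvPolynomial (Fin n) k)
      ((Fin n → MvPolynomial (Fin n) k) ⧸
        Submodule.span (MvPolynomial (Fin n) k) (Set.range M))) = ((n - 1 : ℕ) : WithBot ℕ∞) ↔
      M.det ≠ 0 := by
  have hR : ringKrullDim (MvPolynomial (Fin n) k) = n := by
    rw [MvPolynomial.ringKrullDim_of_isNoetherianRing]; simp
  constructor
  · intro h h0
    rw [ann_bot M h0, ringKrullDim_eq_of_ringEquiv (RingEquiv.quotientBot _), hR] at h
    have : n = n - 1 := by exact_mod_cast h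
    omega
  · intro h
    have hup := ringKrullDim_succ_le_of_surjective
      (Ideal.Quotient.mk (Module.annihilator (MvPolynomial (Fin n) k)
        ((Fin n → MvPolynomial (Fin n) k) ⧸
          Submodule.span (MvPolynomial (Fin n) k) (Set.range M))))
      Ideal.Quotient.mk_surjective (r := M.det) (mem_nonZeroDivisors_of_ne_zero h)
      (Ideal.Quotient.eq_zero_iff_mem.2 (det_mem_ann M))
    have hmem : M.det ∈ RingHom.ker (phi k n n) := by
      rw [RingHom.mem_ker, AlgHom.map_det]
      have : (phi k n n).mapMatrix M = 0 := by
        ext1 i j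
        exact hM i j
      have hne : Nonempty (Fin n) := ⟨⟨0, hn⟩⟩
      rw [this, Matrix.det_zero]
    have := RingHom.ker_isPrime (phi k n n)
    have hlow := Ideal.height_le_ringKrullDim_quotient_add_one hmem
    have hht := height_ker (k := k) (n := n) n le_rfl
    have hrad : ringKrullDim (MvPolynomial (Fin n) k ⧸ Ideal.span {M.det}) =
        ringKrullDim (MvPolynomial (Fin n) k ⧸ (Ideal.span {M.det}).radical) := by
      rw [ringKrullDim_quotient, ringKrullDim_quotient, PrimeSpectrum.zeroLocus_radical]
    have hle := ringKrullDim_le_of_surjective (Ideal.Quotient.factor (ann_le M))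
      (Ideal.Quotient.factor_surjective (ann_le M))
    rw [← hrad] at hle
    rw [hR] at hup
    have hlow' : ((n : ℕ∞) : WithBot ℕ∞) ≤ _ :=
      (WithBot.coe_le_coe.2 hht).trans (hlow.trans (add_le_add_left hle 1))
    have heq := le_antisymm hup hlow'
    exact arith hn _ heq

end S18

/-- Let `k` be a field of characteristic zero, `n ≥ 3`,
`R = k[x₁,…,xₙ]`, and let `f ∈ R` be a nonzero reduced homogeneous polynomial of degree
`d ≥ 3` whose partial derivatives are `k`-linearly independent. Let
`C_f = Rⁿ / ∑ᵢ R·∇f_{xᵢ}` be the cokernel of the Hessian matrix of `f` (here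
`grad i = ∇f_{xᵢ}`). Then the following are equivalent:
(i) the analytic spread of the Jacobian ideal is maximal, i.e. the Krull dimension of
the `k`-subalgebra `k[f_{x₁},…,f_{xₙ}]` of `R` equals `n`;
(ii) the `R`-module `C_f` has Krull dimension `n − 1` (the Krull dimension of a module
being that of `R` modulo its annihilator);
(iii) the gradient vectors `∇f_{x₁},…,∇f_{xₙ} ∈ Rⁿ` are linearly independent over `R`. -/
theorem statement18 (k : Type*) [Field k] [CharZero k] (n d : ℕ)
    (hn : 3 ≤ n) (hd : 3 ≤ d)
    (f : MvPolynomial (Fin n) k) (hf0 : f ≠ 0) (hred : Squarefree f)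
    (hhom : f.IsHomogeneous d)
    (hli : LinearIndependent k (fun i : Fin n => pderiv i f))
    (grad : Fin n → (Fin n → MvPolynomial (Fin n) k))
    (hgrad : ∀ i j, grad i j = pderiv j (pderiv i f)) :
    (ringKrullDim (Algebra.adjoin k (Set.range fun i : Fin n => pderiv i f)) =
          (n : WithBot ℕ∞) ↔
        ringKrullDim (MvPolynomial (Fin n) k ⧸
            Module.annihilator (MvPolynomial (Fin n) k)
              ((Fin n → MvPolynomial (Fin n) k) ⧸
                Submodule.span (MvPolynomial (Fin n) k) (Set.range grad))) =
          ((n - 1 : ℕ) : WithBot ℕ∞)) ∧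
    (ringKrullDim (Algebra.adjoin k (Set.range fun i : Fin n => pderiv i f)) =
          (n : WithBot ℕ∞) ↔
        LinearIndependent (MvPolynomial (Fin n) k) grad) := by
  have hM : ∀ i j, S18.phi k n n (grad i j) = 0 := fun i j => by
    rw [hgrad]
    exact S18.phi_homog (e := d - 1 - 1) (by omega) _ hhom.pderiv.pderiv
  have hdet := S18.dim_ann (Matrix.of grad) (by omega) hM
  have hlin : LinearIndependent (MvPolynomial (Fin n) k) grad ↔ (Matrix.of grad).det ≠ 0 := by
    constructor
    · intro h h0
      obtain ⟨v, hv, hv0⟩ := Matrix.exists_vecMul_eq_zero_iff.2 h0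
      rw [Matrix.vecMul_eq_sum] at hv0
      exact hv (funext (Fintype.linearIndependent_iff.1 h v hv0))
    · intro h
      exact Matrix.linearIndependent_rows_of_det_ne_zero h
  have halg : AlgebraicIndependent k (fun i : Fin n => pderiv i f) ↔
      (Matrix.of grad).det ≠ 0 := by
    constructor
    · intro h h0
      obtain ⟨v, hv, hv0⟩ := Matrix.exists_mulVec_eq_zero_iff.2 h0
      refine hv (S18.ker_zero _ h v fun i => ?_)
      simpa [Matrix.mulVec, dotProduct, hgrad] using congrFun hv0 i
    · intro h
      by_contra hna
      obtain ⟨v, hv, hv0⟩ := S18.exists_rel _ hna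
      refine h (Matrix.exists_vecMul_eq_zero_iff.1 ⟨v, hv, ?_⟩)
      funext j
      simpa [Matrix.vecMul, dotProduct, hgrad] using hv0 j
  have hdim := S18.dim_adjoin (fun i : Fin n => pderiv i f)
  exact ⟨hdim.trans (halg.trans hdet.symm), hdim.trans (halg.trans hlin.symm)⟩
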